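/- arXiv:2203.02868 — 2 statements merged into one kernel-verified Lean document; each statement's English description precedes it below -/
import Mathlib

section
/- For all integers n ≥ k ≥ 1, the greatest common divisor of the multinomial coefficients C(k; j₁, j₂, …, j_m) = k!/(j₁!j₂!⋯j_m!), taken over all tuples (j₁, …, j_m) of nonnegative integers with 1·j₁ + 2·j₂ + ⋯ + m·j_m = n and j₁ + j₂ + ⋯ + j_m = k (where m = n − k + 1), equals k / gcd(n, k). -/
theorem aux_dvd {m : ℕ} (j : Fin m → ℕ) (k : ℕ) (h : ∑ i, j i = k) (i : Fin m) :
    k ∣ j i * Nat.multinomial Finset.univ j := by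
  classical
  have h1 : (Finset.univ : Finset (Fin m)) = insert i (Finset.univ.erase i) := by simp
  have h2 : j i + ∑ x ∈ Finset.univ.erase i, j x = k := by
    rw [← h]; exact Finset.add_sum_erase _ _ (Finset.mem_univ i)
  rw [h1, Nat.multinomial_insert (by simp), h2, ← mul_assoc]
  apply Dvd.dvd.mul_right
  rcases hj : j i with _ | t
  · simp
  · obtain ⟨K, rfl⟩ : ∃ K, k = K + 1 := ⟨k - 1, by omega⟩
    rw [mul_comm, ← Nat.add_one_mul_choose_eq]
    exact Dvd.intro _ rfl

theorem aux_mult {m : ℕ} (a c : Fin m) (hac : a ≠ c) (k d : ℕ) (hd : d ≤ k) :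
    ∃ j : Fin m → ℕ, ∑ i, j i = k ∧ (∀ w : Fin m → ℕ, ∑ i, w i * j i = w a * (k - d) + w c * d) ∧
      Nat.multinomial Finset.univ j = k.choose d := by
  classical
  let j : Fin m → ℕ := fun i => if i = a then k - d else if i = c then d else 0
  have hw : ∀ w : Fin m → ℕ, ∑ i, w i * j i = w a * (k - d) + w c * d := by
    intro w
    rw [← Finset.sum_subset (Finset.subset_univ {a, c}), Finset.sum_pair hac]
    · simp [j, hac.symm]
    · intro x _ hx
      simp only [Finset.mem_insert, Finset.mem_singleton, not_or] at hx
      simp [j, hx.1, hx.2]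
  have hs : ∑ i, j i = k := by
    have := hw (fun _ => 1)
    simp only [one_mul] at this
    omega
  refine ⟨j, hs, hw, ?_⟩
  have hp : ∏ i, (j i).factorial = (k - d).factorial * d.factorial := by
    rw [← Finset.prod_subset (Finset.subset_univ {a, c}), Finset.prod_pair hac]
    · simp [j, hac.symm]
    · intro x _ hx
      simp only [Finset.mem_insert, Finset.mem_singleton, not_or] at hx
      simp [j, hx.1, hx.2]
  rw [Nat.multinomial, hs, hp, Nat.choose_eq_factorial_div_factorial hd, mul_comm]

theorem aux_lucas (p : ℕ) (hp : p.Prime) (b m : ℕ) (hm : 0 < m) :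
    ¬ p ∣ (p ^ b * m - 1).choose (p ^ b - 1) := by
  have := Fact.mk hp
  have key : ∀ x, 0 < x → (p * x - 1) % p = p - 1 ∧ (p * x - 1) / p = x - 1 := by
    intro x hx
    obtain ⟨y, rfl⟩ : ∃ y, x = y + 1 := ⟨x - 1, by omega⟩
    have h1 := hp.pos
    have : p * (y + 1) - 1 = (p - 1) + p * y := by rw [mul_add]; omega
    rw [this, Nat.add_mul_mod_self_left, Nat.add_mul_div_left _ _ h1]
    refine ⟨Nat.mod_eq_of_lt (by omega), ?_⟩
    rw [Nat.div_eq_of_lt (by omega)]; omega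
  induction b with
  | zero => simpa using hp.one_lt.ne'
  | succ b ih =>
    have h := Choose.choose_modEq_choose_mod_mul_choose_div_nat
      (n := p ^ (b+1) * m - 1) (k := p ^ (b+1) - 1) (p := p)
    have hb : 0 < p ^ b := pow_pos hp.pos b
    have e1 := key (p ^ b * m) (by positivity)
    have e2 := key (p ^ b) hb
    rw [pow_succ', mul_assoc, e1.1, e1.2, e2.1, e2.2, Nat.choose_self, one_mul] at h
    rw [pow_succ', mul_assoc, h.dvd_iff dvd_rfl]
    exact ih

theorem gcd_deMoivre_coeffs (n k : ℕ) (hk : 1 ≤ k) (hkn : k ≤ n) :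
    Finset.gcd
      ((Finset.Nat.antidiagonalTuple (n - k + 1) k).filter
        (fun j => ∑ i : Fin (n - k + 1), (i.val + 1) * j i = n))
      (fun j => Nat.multinomial Finset.univ j)
      = k / Nat.gcd n k := by
  have hg : 0 < Nat.gcd n k := Nat.gcd_pos_of_pos_right _ hk
  apply Nat.dvd_antisymm
  · generalize hG : Finset.gcd
      ((Finset.Nat.antidiagonalTuple (n - k + 1) k).filter
        (fun j => ∑ i : Fin (n - k + 1), (i.val + 1) * j i = n))
      (fun j => Nat.multinomial Finset.univ j) = G
    have hmem : ∀ j : Fin (n - k + 1) → ℕ, ∑ i, j i = k →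
        ∑ i : Fin (n - k + 1), (i.val + 1) * j i = n → G ∣ Nat.multinomial Finset.univ j := by
      intro j h1 h2
      rw [← hG]
      exact Finset.gcd_dvd (f := fun j => Nat.multinomial Finset.univ j)
        (by simp [Finset.Nat.mem_antidiagonalTuple, h1, h2])
    rcases Nat.eq_or_lt_of_le hkn with rfl | hlt
    · have h := hmem (fun i => if i = 0 then k else 0) (by simp) (by simp)
      rw [Nat.gcd_self, Nat.div_self hk]
      have e : Nat.multinomial Finset.univ
          (fun i : Fin (k - k + 1) => if i = 0 then k else 0) = 1 := by
        have hp : ∏ i : Fin (k - k + 1), (if i = 0 then k else 0).factorial = k.factorial := by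
          rw [Finset.prod_eq_single 0] <;> simp +contextual
        rw [Nat.multinomial, hp]
        simp [Nat.div_self (Nat.factorial_pos k)]
      rwa [e] at h
    have hch : ∀ d, 0 < d → d ∣ n → d ∣ k → G ∣ k.choose d := by
      intro d hd0 hdn hdk
      have hdN : d ∣ n - k := Nat.dvd_sub hdn hdk
      have hpos : 0 < (n - k) / d := Nat.div_pos (Nat.le_of_dvd (by omega) hdN) hd0
      obtain ⟨j, h1, h2, h3⟩ := aux_mult (m := n - k + 1) 0
        ⟨(n - k) / d, Nat.lt_succ_of_le (Nat.div_le_self _ _)⟩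
        (by intro h; have := congrArg Fin.val h; simp at this; omega) k d (Nat.le_of_dvd hk hdk)
      rw [← h3]
      refine hmem j h1 ?_
      rw [h2 (fun i => i.val + 1)]
      have := Nat.div_mul_cancel hdN
      have := Nat.le_of_dvd hk hdk
      simp only [Fin.val_zero, add_mul]
      omega
    apply Nat.dvd_div_of_mul_dvd
    have hG0 : G ≠ 0 := by
      rintro rfl
      have := hch 1 one_pos (one_dvd _) (one_dvd _)
      simp at this; omega
    rw [← Nat.factorization_prime_le_iff_dvd (by positivity) (by omega)]
    intro p hp
    set b := (Nat.gcd n k).factorization p with hb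
    have hdv : p ^ b ∣ Nat.gcd n k := Nat.ordProj_dvd _ _
    have hpb : 0 < p ^ b := pow_pos hp.pos b
    have hdk := hdv.trans (Nat.gcd_dvd_right _ _)
    have hC := hch (p ^ b) hpb (hdv.trans (Nat.gcd_dvd_left _ _)) hdk
    obtain ⟨m, hm⟩ := hdk
    have hm0 : 0 < m := by
      rcases Nat.eq_zero_or_pos m with h | h
      · rw [h, mul_zero] at hm; omega
      · exact h
    have hu := aux_lucas p hp b m hm0
    rw [← hm] at hu
    have hid : k.choose (p ^ b) * p ^ b = k * (k - 1).choose (p ^ b - 1) := by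
      have := Nat.add_one_mul_choose_eq (k - 1) (p ^ b - 1)
      rw [Nat.sub_add_cancel hk, Nat.sub_add_cancel hpb] at this
      exact this.symm
    have hu0 : (k - 1).choose (p ^ b - 1) ≠ 0 := by intro h; simp [h] at hu
    have hd : G * p ^ b ∣ k * (k - 1).choose (p ^ b - 1) := hid ▸ Nat.mul_dvd_mul_right hC _
    have hle := (Nat.factorization_prime_le_iff_dvd (by positivity) (by positivity)).2 hd p hp
    rw [Nat.factorization_mul hG0 hpb.ne', Nat.factorization_mul (by omega) hu0] at hle
    simp only [Finsupp.add_apply, Nat.factorization_eq_zero_of_not_dvd hu,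
      hp.factorization_pow, Finsupp.single_eq_same] at hle
    rw [Nat.factorization_mul (by omega) (by omega)]
    simp only [Finsupp.add_apply, ← hb]
    omega
  · apply Finset.dvd_gcd
    intro j hj
    rw [Finset.mem_filter, Finset.Nat.mem_antidiagonalTuple] at hj
    obtain ⟨h1, h2⟩ := hj
    rw [Nat.div_dvd_iff_dvd_mul (Nat.gcd_dvd_right _ _) hg]
    rw [← Nat.gcd_mul_right]
    refine Nat.dvd_gcd ?_ (Dvd.intro _ rfl)
    suffices h : k ∣ (∑ i : Fin (n - k + 1), (i.val + 1) * j i) * Nat.multinomial Finset.univ j from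
      (congrArg (fun x => k ∣ x * Nat.multinomial Finset.univ j) h2).mp h
    rw [Finset.sum_mul]
    refine Finset.dvd_sum fun i _ => ?_
    rw [mul_assoc]
    exact (aux_dvd j k h1 i).mul_left _
end

section
/- Let α and β be positive integers. Then the greatest common divisor of the binomial coefficients C(αβ, d), taken over all positive divisors d of β, divides α. -/
theorem not_dvd_choose_pred (p k N : ℕ) (hp : p.Prime) (h : p ^ k ∣ N + 1) (j : ℕ)
    (hj : j < p ^ k) : ¬ p ∣ N.choose j := by
  induction j with
  | zero => simpa using hp.one_lt.ne'
  | succ j ih =>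
    intro hd
    apply ih (by omega)
    have h1 : p ∣ (N + 1).choose (j + 1) := by
      by_contra hn
      have hc : Nat.Coprime (p ^ k) ((N + 1).choose (j + 1)) :=
        Nat.Coprime.pow_left k ((Nat.Prime.coprime_iff_not_dvd hp).2 hn)
      have h2 : p ^ k ∣ (N + 1).choose (j + 1) * (j + 1) := by
        rw [← Nat.add_one_mul_choose_eq]
        exact Dvd.dvd.mul_right h _
      have h3 := Nat.le_of_dvd (by omega) (hc.dvd_of_dvd_mul_left h2)
      omega
    rw [Nat.choose_succ_succ] at h1
    exact (Nat.dvd_add_left hd).1 h1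

/-- The gcd of the binomial coefficients `C(αβ, d)`, over all positive divisors `d`
of `β`, divides `α`. -/
theorem gcd_choose_divisors_dvd (α β : ℕ) (hα : 0 < α) (hβ : 0 < β) :
    Finset.gcd (Nat.divisors β) (fun d => (α * β).choose d) ∣ α := by
  rw [Nat.dvd_iff_prime_pow_dvd_dvd]
  intro p j hp hj
  obtain ⟨k, m, hm, hb⟩ := Nat.exists_eq_pow_mul_and_not_dvd hβ.ne' p hp.ne_one
  have hd : p ^ j ∣ (α * β).choose (p ^ k) := hj.trans
    (Finset.gcd_dvd (f := fun d => (α * β).choose d)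
      (Nat.mem_divisors.2 ⟨⟨m, hb⟩, hβ.ne'⟩))
  obtain ⟨N, hN⟩ : ∃ N, α * β = N + 1 :=
    Nat.exists_eq_succ_of_ne_zero (Nat.mul_pos hα hβ).ne'
  have hq : 0 < p ^ k := pow_pos hp.pos k
  obtain ⟨q, hq'⟩ : ∃ q, p ^ k = q + 1 := Nat.exists_eq_succ_of_ne_zero hq.ne'
  have hnd : ¬ p ∣ N.choose q := by
    apply not_dvd_choose_pred p k N hp _ q (by omega)
    rw [← hN, hb]
    exact Dvd.intro_left (α * m) (by ring)
  have key := Nat.add_one_mul_choose_eq N q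
  rw [← hN, ← hq', hb] at key
  have key2 : (α * β).choose (p ^ k) = α * (m * N.choose q) := by
    apply Nat.eq_of_mul_eq_mul_right hq
    rw [hb, ← key]
    ring
  rw [key2] at hd
  refine Nat.Coprime.dvd_of_dvd_mul_right (Nat.Coprime.pow_left j ?_) hd
  rw [Nat.Prime.coprime_iff_not_dvd hp, hp.dvd_mul]
  tauto
end
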